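/- Let q, s ∈ [1,∞] and A = (α₀, α_∞), B = (β₀, β_∞) ∈ ℝ² be such that (∞,q,A) and (∞,s,B) are admissible Lorentz–Zygmund parameters. Assume that either (i) α_∞ + 1/q > 0 and α_∞ + 1/q > β_∞ + 1/s, or (ii) q < ∞ and 0 = α_∞ + 1/q > β_∞ + 1/s. Then lim_{a→∞} sup{ ‖f^* χ_{(a,∞)}‖_{L^{∞,s,B}(0,∞)} : f measurable on (0,∞), ‖f‖_{L^{∞,q,A}(0,∞)} ≤ 1 } = 0. -/

import Mathlib

open MeasureTheory Set Filter Topology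
open scoped ENNReal NNReal

noncomputable section

/-- The nonincreasing rearrangement of an `ℝ≥0∞`-valued function with respect to `μ`:
`f^*(t) = inf {λ : μ({f > λ}) ≤ t}`. -/
def rearr {α : Type*} [MeasurableSpace α] (μ : Measure α) (f : α → ℝ≥0∞) (t : ℝ) : ℝ≥0∞ :=
  sInf {l : ℝ≥0∞ | μ {x | l < f x} ≤ ENNReal.ofReal t}

/-- Lebesgue measure on `(0,∞)`. -/
def μI : Measure ℝ := volume.restrict (Set.Ioi (0 : ℝ))

/-- `ℓ(t) = 1 + |log t|`. -/
def ell (t : ℝ) : ℝ := 1 + |Real.log t|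

/-- The broken-logarithm power `ℓ^A(t)`, equal to `ℓ(t)^{α₀}` for `t ≤ 1` and to
`ℓ(t)^{α_∞}` for `t > 1`, where `A = (α₀, α_∞)`. -/
def ellA (A : ℝ × ℝ) (t : ℝ) : ℝ := if t ≤ 1 then ell t ^ A.1 else ell t ^ A.2

/-- The `L^q(0,∞)` norm (with `q ∈ [1,∞]`) of a nonnegative function. -/
def lqNorm (q : ℝ≥0∞) (g : ℝ → ℝ≥0∞) : ℝ≥0∞ :=
  if q = ∞ then essSup g μI
  else (∫⁻ t in Set.Ioi (0 : ℝ), g t ^ q.toReal) ^ q.toReal⁻¹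

/-- The Lorentz–Zygmund functional
`‖f‖_{L^{p,q,A}(0,∞)} = ‖ t^{1/p - 1/q} ℓ^A(t) f^*(t) ‖_{L^q(0,∞)}`
(with the conventions `1/∞ = 0`). -/
def lzNorm (p q : ℝ≥0∞) (A : ℝ × ℝ) (f : ℝ → ℝ≥0∞) : ℝ≥0∞ :=
  lqNorm q fun t => ENNReal.ofReal (t ^ (p.toReal⁻¹ - q.toReal⁻¹) * ellA A t) * rearr μI f t

/-- Admissibility of Lorentz–Zygmund parameters: the functional `‖·‖_{L^{p,q,A}}` is
equivalent to a rearrangement-invariant norm. -/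
def LZAdmissible (p q : ℝ≥0∞) (A : ℝ × ℝ) : Prop :=
  (p = 1 ∧ q = 1 ∧ 0 ≤ A.1 ∧ A.2 ≤ 0) ∨
  (1 < p ∧ p < ∞ ∧ 1 ≤ q) ∨
  (p = ∞ ∧ 1 ≤ q ∧ q < ∞ ∧ A.1 + q.toReal⁻¹ < 0) ∨
  (p = ∞ ∧ q = ∞ ∧ A.1 ≤ 0)


lemma rearr_anti (f : ℝ → ℝ≥0∞) : Antitone (rearr μI f) := by
  intro t u htu
  apply sInf_le_sInf
  intro l hl
  exact le_trans hl (ENNReal.ofReal_le_ofReal htu)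

lemma rearr_tail (f : ℝ → ℝ≥0∞) (hf : Antitone f) (a t : ℝ) :
    rearr μI ((Set.Ioi a).indicator f) t ≤ f (t + a) := by
  apply sInf_le
  show μI {x | f (t + a) < (Set.Ioi a).indicator f x} ≤ ENNReal.ofReal t
  have hsub : {x | f (t + a) < (Set.Ioi a).indicator f x} ⊆ Set.Ioo a (t + a) := by
    intro x hx
    simp only [Set.mem_ofPred_eq] at hx
    by_cases hxa : x ∈ Set.Ioi a
    · rw [Set.indicator_of_mem hxa] at hx
      refine ⟨hxa, ?_⟩
      by_contra h
      exact absurd (hf (not_lt.1 h)) (not_le.2 hx)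
    · rw [Set.indicator_of_notMem hxa] at hx
      exact absurd hx not_lt_zero
  calc μI _ ≤ volume _ := Measure.restrict_le_self _
    _ ≤ volume (Set.Ioo a (t + a)) := measure_mono hsub
    _ = ENNReal.ofReal t := by rw [Real.volume_Ioo]; congr 1; ring

lemma one_le_ell (t : ℝ) : 1 ≤ ell t := by
  unfold ell; linarith [abs_nonneg (Real.log t)]

lemma ell_pos (t : ℝ) : 0 < ell t := lt_of_lt_of_le one_pos (one_le_ell t)

lemma ell_eq {t : ℝ} (ht : 1 ≤ t) : ell t = 1 + Real.log t := by
  unfold ell; rw [abs_of_nonneg (Real.log_nonneg ht)]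

lemma ell_mono {t u : ℝ} (ht : 1 ≤ t) (htu : t ≤ u) : ell t ≤ ell u := by
  rw [ell_eq ht, ell_eq (ht.trans htu)]
  have := Real.log_le_log (by linarith) htu
  linarith

lemma ellA_pos (A : ℝ × ℝ) (t : ℝ) : 0 < ellA A t := by
  unfold ellA; split_ifs <;> exact Real.rpow_pos_of_pos (ell_pos t) _

lemma lint_log (δ : ℝ) (hδ : 1 < δ) :
    ∫⁻ t in Set.Ioi (0:ℝ), ENNReal.ofReal (t⁻¹ * ell t ^ (-δ)) < ∞ := by
  have h1 := lintegral_image_eq_lintegral_abs_deriv_mul (s := Set.univ) (f := Real.exp)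
    (f' := Real.exp) MeasurableSet.univ
    (fun x _ => (Real.hasDerivAt_exp x).hasDerivWithinAt) (Real.exp_injective.injOn)
    (fun t => ENNReal.ofReal (t⁻¹ * ell t ^ (-δ)))
  rw [Set.image_univ, Real.range_exp] at h1
  rw [h1]
  have h2 := finite_integral_one_add_norm (E := ℝ) (μ := volume) (r := δ) (by simpa using hδ)
  refine lt_of_le_of_lt ?_ h2
  rw [Measure.restrict_univ]
  apply lintegral_mono
  intro x
  simp only
  rw [← ENNReal.ofReal_mul (abs_nonneg _), ← mul_assoc, abs_of_pos (Real.exp_pos x),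
    mul_inv_cancel₀ (Real.exp_pos x).ne', one_mul]
  unfold ell
  rw [Real.log_exp, Real.norm_eq_abs]

lemma weight_pow {r t y : ℝ} (hr : 0 < r) (ht : 0 < t) (hy : 0 < y) :
    (ENNReal.ofReal (t ^ (0 - r⁻¹) * y)) ^ r = ENNReal.ofReal (t⁻¹ * y ^ r) := by
  have h0 : 0 < t ^ (0 - r⁻¹) := Real.rpow_pos_of_pos ht _
  rw [ENNReal.ofReal_rpow_of_nonneg (by positivity) hr.le, Real.mul_rpow h0.le hy.le,
    ← Real.rpow_mul ht.le]
  have : (0 - r⁻¹) * r = -1 := by field_simp; ring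
  rw [this, Real.rpow_neg_one]

lemma norm_bound (s : ℝ≥0∞) (B : ℝ × ℝ) (γ : ℝ) (hB : LZAdmissible ∞ s B)
    (hγ : B.2 + s.toReal⁻¹ < γ) :
    ∃ K : ℝ≥0∞, K ≠ ∞ ∧ ∀ (G : ℝ → ℝ≥0∞) (η : ℝ≥0∞),
      (∀ t, 0 < t → G t ≤ η * ENNReal.ofReal (ellA (0, -γ) t)) →
      lqNorm s (fun t => ENNReal.ofReal (t ^ ((∞ : ℝ≥0∞).toReal⁻¹ - s.toReal⁻¹) * ellA B t) * G t)
        ≤ η * K := by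
  have hm : ∀ t, ellA B t * ellA (0, -γ) t = if t ≤ 1 then ell t ^ B.1 else ell t ^ (B.2 - γ) := by
    intro t
    unfold ellA
    split_ifs
    · simp
    · rw [← Real.rpow_add (ell_pos t)]; simp [sub_eq_add_neg]
  rcases hB with h | h | ⟨-, h1, h2, h3⟩ | ⟨-, h1, h2⟩
  · simp at h
  · simp at h
  · have hr : 0 < s.toReal := ENNReal.toReal_pos (by intro h; simp [h] at h1) h2.ne
    set r := s.toReal with hrdef
    set δ := min (-(B.1 * r)) (-((B.2 - γ) * r)) with hδ
    have hδ1 : 1 < δ := by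
      have e : r⁻¹ * r = 1 := inv_mul_cancel₀ hr.ne'
      apply lt_min
      · nlinarith
      · nlinarith
    have hle : ∀ t, (ellA B t * ellA (0, -γ) t) ^ r ≤ ell t ^ (-δ) := by
      intro t
      rw [hm]
      split_ifs
      · rw [← Real.rpow_mul (ell_pos t).le]
        apply Real.rpow_le_rpow_of_exponent_le (one_le_ell t)
        have := min_le_left (-(B.1 * r)) (-((B.2 - γ) * r))
        linarith
      · rw [← Real.rpow_mul (ell_pos t).le]
        apply Real.rpow_le_rpow_of_exponent_le (one_le_ell t)
        have := min_le_right (-(B.1 * r)) (-((B.2 - γ) * r))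
        linarith
    refine ⟨(∫⁻ t in Set.Ioi (0:ℝ), ENNReal.ofReal (t⁻¹ * ell t ^ (-δ))) ^ r⁻¹,
      ENNReal.rpow_ne_top_of_nonneg (by positivity) (lint_log δ hδ1).ne, ?_⟩
    intro G η hG
    unfold lqNorm
    rw [if_neg h2.ne]
    have hη : η = (η ^ r) ^ r⁻¹ := by
      rw [← ENNReal.rpow_mul, mul_inv_cancel₀ hr.ne', ENNReal.rpow_one]
    have hmeas : Measurable fun t : ℝ => ENNReal.ofReal (t⁻¹ * ell t ^ (-δ)) := by
      unfold ell
      have := Real.measurable_log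
      have h' : Measurable fun t : ℝ => 1 + |Real.log t| := by
        simpa [Real.norm_eq_abs] using (this.norm.const_add 1)
      exact (measurable_inv.mul (h'.pow_const _)).ennreal_ofReal
    rw [hη, ← ENNReal.mul_rpow_of_nonneg _ _ (by positivity : 0 ≤ r⁻¹), ← lintegral_const_mul _ hmeas]
    apply ENNReal.rpow_le_rpow _ (by positivity)
    apply setLIntegral_mono' measurableSet_Ioi
    intro t ht
    have ht : 0 < t := ht
    simp only [ENNReal.toReal_top, inv_zero]
    calc _ ≤ (ENNReal.ofReal (t ^ (0 - r⁻¹) * ellA B t) * (η * ENNReal.ofReal (ellA (0, -γ) t))) ^ r := by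
          gcongr; exact hG t ht
      _ = (η * ENNReal.ofReal (t ^ (0 - r⁻¹) * (ellA B t * ellA (0, -γ) t))) ^ r := by
          rw [← mul_assoc (t ^ _), ENNReal.ofReal_mul (p := t ^ (0 - r⁻¹) * ellA B t)
            (mul_nonneg (Real.rpow_nonneg ht.le _) (ellA_pos _ _).le)]
          ring
      _ = η ^ r * ENNReal.ofReal (t⁻¹ * (ellA B t * ellA (0, -γ) t) ^ r) := by
          rw [ENNReal.mul_rpow_of_nonneg _ _ hr.le, weight_pow hr ht (mul_pos (ellA_pos _ _) (ellA_pos _ _))]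
      _ ≤ _ := by
          gcongr; exact hle t
  · subst h1
    refine ⟨1, by simp, ?_⟩
    intro G η hG
    unfold lqNorm
    rw [if_pos rfl, mul_one]
    refine essSup_le_of_ae_le _ ?_
    unfold μI
    filter_upwards [ae_restrict_mem measurableSet_Ioi] with t ht
    have ht : 0 < t := ht
    simp only [ENNReal.toReal_top, inv_zero, sub_zero, Real.rpow_zero, one_mul, add_zero] at *
    calc _ ≤ ENNReal.ofReal (ellA B t) * (η * ENNReal.ofReal (ellA (0, -γ) t)) := by
          gcongr; exact hG t ht
      _ = η * ENNReal.ofReal (ellA B t * ellA (0, -γ) t) := by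
          rw [ENNReal.ofReal_mul (ellA_pos _ _).le]; ring
      _ ≤ η * 1 := by
          gcongr
          rw [ENNReal.ofReal_le_one, hm]
          split_ifs
          · exact Real.rpow_le_one_of_one_le_of_nonpos (one_le_ell t) h2
          · exact Real.rpow_le_one_of_one_le_of_nonpos (one_le_ell t) (by linarith)
      _ = η := mul_one η

lemma fin_bound (q : ℝ≥0∞) (A : ℝ × ℝ) (h1 : 1 ≤ q) (h2 : q < ∞) (f : ℝ → ℝ≥0∞)
    (hf : lzNorm ∞ q A f ≤ 1) (c t : ℝ) (hc : 1 ≤ c) :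
    rearr μI f t ^ q.toReal *
      ∫⁻ u in Set.Ioc c t, ENNReal.ofReal (u⁻¹ * ell u ^ (A.2 * q.toReal)) ≤ 1 := by
  have hr : 0 < q.toReal := ENNReal.toReal_pos (by intro h; simp [h] at h1) h2.ne
  unfold lzNorm lqNorm at hf
  rw [if_neg h2.ne] at hf
  set r := q.toReal with hrdef
  have hf' := ENNReal.rpow_le_rpow hf hr.le
  rw [← ENNReal.rpow_mul, inv_mul_cancel₀ hr.ne', ENNReal.rpow_one, ENNReal.one_rpow] at hf'
  refine le_trans ?_ hf'
  have hmeas : Measurable fun u : ℝ => ENNReal.ofReal (u⁻¹ * ell u ^ (A.2 * r)) := by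
    unfold ell
    have := Real.measurable_log
    have h' : Measurable fun t : ℝ => 1 + |Real.log t| := by
      simpa [Real.norm_eq_abs] using (this.norm.const_add 1)
    exact (measurable_inv.mul (h'.pow_const _)).ennreal_ofReal
  rw [← lintegral_const_mul _ hmeas]
  have hsub : Set.Ioc c t ⊆ Set.Ioi 0 := fun u hu => lt_trans (by linarith) hu.1
  refine le_trans ?_ (lintegral_mono_set hsub)
  apply setLIntegral_mono' measurableSet_Ioc
  intro u hu
  have hu0 : 0 < u := hsub hu
  simp only [ENNReal.toReal_top, inv_zero]
  rw [ENNReal.mul_rpow_of_nonneg _ _ hr.le, weight_pow hr hu0 (ellA_pos _ _), mul_comm]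
  have : ellA A u = ell u ^ A.2 := by
    unfold ellA; rw [if_neg]; have := hu.1; linarith
  rw [this, ← Real.rpow_mul (ell_pos u).le]
  gcongr
  exact rearr_anti f hu.2

lemma sqrt_facts {t u : ℝ} (ht : 1 ≤ t) (hu : Real.sqrt t ≤ u) (hut : u ≤ t) :
    1 ≤ u ∧ ell t / 2 ≤ ell u ∧ ell u ≤ ell t := by
  have h1 : 1 ≤ Real.sqrt t := by rw [Real.one_le_sqrt]; exact ht
  have h2 : 1 ≤ u := h1.trans hu
  refine ⟨h2, ?_, ell_mono h2 hut⟩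
  have h3 := ell_mono h1 hu
  rw [ell_eq h1, Real.log_sqrt (by linarith)] at h3
  rw [ell_eq ht]; linarith

lemma rpow_half {x y p : ℝ} (hx : 0 < x) (h1 : x / 2 ≤ y) (h2 : y ≤ x) :
    2 ^ (-|p|) * x ^ p ≤ y ^ p := by
  rcases le_total 0 p with hp | hp
  · rw [abs_of_nonneg hp, Real.rpow_neg (by norm_num), mul_comm, ← div_eq_mul_inv,
      ← Real.div_rpow hx.le (by norm_num)]
    exact Real.rpow_le_rpow (by positivity) h1 hp
  · calc _ ≤ 1 * x ^ p := by
          gcongr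
          exact Real.rpow_le_one_of_one_le_of_nonpos (by norm_num) (by simp)
      _ = x ^ p := one_mul _
      _ ≤ _ := Real.rpow_le_rpow_of_nonpos (by linarith) h2 hp

lemma pow_mul_le {x : ℝ≥0∞} {r y : ℝ} (hr : 0 < r) (hy : 0 < y)
    (h : x ^ r * ENNReal.ofReal y ≤ 1) : x ≤ ENNReal.ofReal (y ^ (-r⁻¹)) := by
  have h1 : x ^ r ≤ (ENNReal.ofReal y)⁻¹ := by
    rw [ENNReal.le_inv_iff_mul_le]; exact h
  rw [← ENNReal.ofReal_inv_of_pos hy] at h1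
  have h2 := ENNReal.rpow_le_rpow h1 (by positivity : 0 ≤ r⁻¹)
  rw [← ENNReal.rpow_mul, mul_inv_cancel₀ hr.ne', ENNReal.rpow_one,
    ENNReal.ofReal_rpow_of_nonneg (by positivity) (by positivity)] at h2
  rw [Real.rpow_neg hy.le, ← Real.inv_rpow hy.le]
  exact h2

lemma ptwise (q : ℝ≥0∞) (A : ℝ × ℝ) (hA : LZAdmissible ∞ q A) (h0 : 0 < A.2 + q.toReal⁻¹) :
    ∃ C : ℝ, 0 < C ∧ ∀ f : ℝ → ℝ≥0∞, lzNorm ∞ q A f ≤ 1 → ∀ t, Real.exp 1 ≤ t →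
      rearr μI f t ≤ ENNReal.ofReal (C * ell t ^ (-(A.2 + q.toReal⁻¹))) := by
  have he : ∀ t, Real.exp 1 ≤ t → 1 < t ∧ 1 ≤ Real.log t := by
    intro t ht
    have : 1 < Real.exp 1 := by simp
    refine ⟨this.trans_le ht, ?_⟩
    rw [Real.le_log_iff_exp_le (by linarith)]; exact ht
  rcases hA with h | h | ⟨-, h1, h2, h3⟩ | ⟨-, h1, h2⟩
  · simp at h
  · simp at h
  · have hr : 0 < q.toReal := ENNReal.toReal_pos (by intro h; simp [h] at h1) h2.ne
    set r := q.toReal with hrdef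
    set c : ℝ := 2 ^ (-|A.2 * r|) / 4 with hc
    have hcpos : 0 < c := by positivity
    refine ⟨c ^ (-r⁻¹), by positivity, ?_⟩
    intro f hf t ht
    obtain ⟨ht1, hlt⟩ := he t ht
    have hs1 : 1 ≤ Real.sqrt t := by rw [Real.one_le_sqrt]; exact ht1.le
    have hst : Real.sqrt t ≤ t := by
      rw [Real.sqrt_le_left (by linarith)]; nlinarith
    have hb := fin_bound q A h1 h2 f hf (Real.sqrt t) t hs1
    have hl := ell_pos t
    have key : ENNReal.ofReal (c * ell t ^ (A.2 * r + 1)) ≤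
        ∫⁻ u in Set.Ioc (Real.sqrt t) t, ENNReal.ofReal (u⁻¹ * ell u ^ (A.2 * r)) := by
      have hint : IntegrableOn (fun u : ℝ => u⁻¹) (Set.Ioc (Real.sqrt t) t) := by
        have : IntervalIntegrable (fun u : ℝ => u⁻¹) volume (Real.sqrt t) t := by
          apply ContinuousOn.intervalIntegrable
          rw [Set.uIcc_of_le hst]
          exact continuousOn_id.inv₀ (fun u hu => by have := hu.1; simp only [id]; linarith)
        exact (intervalIntegrable_iff_integrableOn_Ioc_of_le hst).1 this
      have hI : ∫⁻ u in Set.Ioc (Real.sqrt t) t, ENNReal.ofReal (u⁻¹) = ENNReal.ofReal (Real.log t / 2) := by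
        rw [← ofReal_integral_eq_lintegral_ofReal hint]
        · rw [← intervalIntegral.integral_of_le hst, integral_inv_of_pos (by linarith) (by linarith),
            Real.log_div (by linarith) (by linarith), Real.log_sqrt (by linarith)]
          congr 1; ring
        · filter_upwards [ae_restrict_mem measurableSet_Ioc] with u hu
          have := hu.1
          simp only [Pi.zero_apply]
          exact inv_nonneg.2 (by linarith)
      calc ENNReal.ofReal (c * ell t ^ (A.2 * r + 1))
          ≤ ENNReal.ofReal ((2 ^ (-|A.2 * r|) * ell t ^ (A.2 * r)) * (Real.log t / 2)) := by
            apply ENNReal.ofReal_le_ofReal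
            rw [Real.rpow_add hl, Real.rpow_one, hc]
            have : ell t ≤ 2 * Real.log t := by rw [ell_eq ht1.le]; linarith
            have hp : 0 < (2:ℝ) ^ (-|A.2 * r|) * ell t ^ (A.2 * r) := by positivity
            nlinarith
        _ = ∫⁻ u in Set.Ioc (Real.sqrt t) t,
            ENNReal.ofReal (2 ^ (-|A.2 * r|) * ell t ^ (A.2 * r)) * ENNReal.ofReal (u⁻¹) := by
            rw [lintegral_const_mul _ measurable_inv.ennreal_ofReal, hI, ENNReal.ofReal_mul (by positivity)]
        _ ≤ _ := by
            apply setLIntegral_mono' measurableSet_Ioc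
            intro u hu
            obtain ⟨g1, g2, g3⟩ := sqrt_facts ht1.le hu.1.le hu.2
            rw [← ENNReal.ofReal_mul (by positivity), mul_comm]
            apply ENNReal.ofReal_le_ofReal
            have := rpow_half (p := A.2 * r) hl g2 g3
            have : 0 < u⁻¹ := by positivity
            gcongr
    have h4 := pow_mul_le hr (by positivity) ((mul_le_mul_right key _).trans hb)
    refine h4.trans (ENNReal.ofReal_le_ofReal (le_of_eq ?_))
    rw [Real.mul_rpow hcpos.le (by positivity), ← Real.rpow_mul hl.le]
    congr 2
    field_simp
  · subst h1
    simp only [ENNReal.toReal_top, inv_zero, add_zero] at *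
    refine ⟨2 ^ A.2, by positivity, ?_⟩
    intro f hf t ht
    obtain ⟨ht1, hlt⟩ := he t ht
    have hst : Real.sqrt t < t := by
      rw [Real.sqrt_lt' (by linarith)]; nlinarith
    unfold lzNorm lqNorm at hf
    rw [if_pos rfl] at hf
    have hae := ENNReal.ae_le_essSup (μ := μI) (fun t => ENNReal.ofReal (t ^ ((∞:ℝ≥0∞).toReal⁻¹ - (∞:ℝ≥0∞).toReal⁻¹) * ellA A t) * rearr μI f t)
    unfold μI at hae
    rw [ae_restrict_iff' measurableSet_Ioi] at hae
    have : ∃ u ∈ Set.Ioo (Real.sqrt t) t, u ∈ Set.Ioi (0:ℝ) → 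
        ENNReal.ofReal (u ^ ((∞:ℝ≥0∞).toReal⁻¹ - (∞:ℝ≥0∞).toReal⁻¹) * ellA A u) * rearr μI f u ≤ 1 := by
      have hfr : ∃ᵐ u ∂volume, u ∈ Set.Ioo (Real.sqrt t) t := by
        rw [frequently_ae_mem_iff, Real.volume_Ioo]
        simpa using ht1
      obtain ⟨u, hu1, hu2⟩ := (hfr.and_eventually hae).exists
      exact ⟨u, hu1, fun h => (hu2 h).trans hf⟩
    obtain ⟨u, hu, h5⟩ := this
    obtain ⟨g1, g2, g3⟩ := sqrt_facts ht1.le hu.1.le hu.2.le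
    have h5 := h5 (show (0:ℝ) < u by linarith)
    have hu1 : 1 < u := by
      have : 1 ≤ Real.sqrt t := by rw [Real.one_le_sqrt]; exact ht1.le
      linarith [hu.1]
    have hlt := ell_pos t
    have hlu := ell_pos u
    have h6 : ellA A u = ell u ^ A.2 := by
      unfold ellA; rw [if_neg (by linarith)]
    rw [h6] at h5
    simp only [sub_self, Real.rpow_zero, one_mul] at h5
    rw [mul_comm, ← ENNReal.rpow_one (rearr μI f u)] at h5
    have h7 := pow_mul_le one_pos (by positivity) h5
    refine (rearr_anti f hu.2.le).trans (h7.trans (ENNReal.ofReal_le_ofReal ?_))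
    rw [inv_one, Real.rpow_neg_one, Real.rpow_neg hlt.le, ← div_eq_mul_inv, inv_le_comm₀ (by positivity) (by positivity), inv_div,
      ← Real.div_rpow hlt.le (by norm_num)]
    exact Real.rpow_le_rpow (by positivity) g2 h0.le

lemma tendsto_ell : Tendsto ell atTop atTop := by
  have : Tendsto (fun t => 1 + Real.log t) atTop atTop :=
    tendsto_atTop_add_const_left _ _ Real.tendsto_log_atTop
  refine this.congr' ?_
  filter_upwards [eventually_ge_atTop 1] with t ht
  exact (ell_eq ht).symm

lemma decay (q : ℝ≥0∞) (A : ℝ × ℝ) (b : ℝ) (hA : LZAdmissible ∞ q A)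
    (hcond : (0 < A.2 + q.toReal⁻¹ ∧ b < A.2 + q.toReal⁻¹) ∨
      (q < ∞ ∧ A.2 + q.toReal⁻¹ = 0 ∧ b < A.2 + q.toReal⁻¹)) :
    ∃ (γ : ℝ) (η : ℝ → ℝ≥0∞), b < γ ∧ Tendsto η atTop (𝓝 0) ∧ ∀ᶠ a in atTop,
      ∀ f : ℝ → ℝ≥0∞, lzNorm ∞ q A f ≤ 1 → ∀ t, 0 < t →
        rearr μI f (t + a) ≤ η a * ENNReal.ofReal (ellA (0, -γ) t) := by
  rcases hcond with ⟨h0, hb⟩ | ⟨hq, h0, hb⟩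
  · obtain ⟨C, hC, hCf⟩ := ptwise q A hA h0
    set ρ := A.2 + q.toReal⁻¹ with hρ
    obtain ⟨γ, hγ1, hγ2⟩ : ∃ γ, max 0 b < γ ∧ γ < ρ := exists_between (max_lt h0 hb)
    have hγ0 : 0 < γ := (le_max_left _ _).trans_lt hγ1
    refine ⟨γ, fun a => ENNReal.ofReal (C * ell a ^ (-(ρ - γ))), (le_max_right _ _).trans_lt hγ1, ?_, ?_⟩
    · have := ((tendsto_rpow_neg_atTop (sub_pos.2 hγ2)).comp tendsto_ell).const_mul C
      rw [mul_zero] at this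
      have := ENNReal.tendsto_ofReal this
      simpa using this
    · filter_upwards [eventually_ge_atTop (Real.exp 1)] with a ha f hf t ht
      have ha1 : 1 < a := lt_of_lt_of_le (by simp) ha
      refine (hCf f hf (t + a) (by linarith)).trans ?_
      have e1 := ell_pos a
      rw [← ENNReal.ofReal_mul (by positivity)]
      apply ENNReal.ofReal_le_ofReal
      have e2 : ell (t + a) ^ (-ρ) = ell (t + a) ^ (-(ρ - γ)) * ell (t + a) ^ (-γ) := by
        rw [← Real.rpow_add (ell_pos _)]; congr 1; ring
      have e3 := ell_pos (t + a)
      rw [e2, mul_assoc]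
      have i1 : ell (t + a) ^ (-(ρ - γ)) ≤ ell a ^ (-(ρ - γ)) :=
        Real.rpow_le_rpow_of_nonpos e1 (ell_mono ha1.le (by linarith)) (by linarith)
      have i2 : ell (t + a) ^ (-γ) ≤ ellA (0, -γ) t := by
        unfold ellA
        split_ifs with h
        · simp only [Real.rpow_zero]
          exact Real.rpow_le_one_of_one_le_of_nonpos (one_le_ell _) (by linarith)
        · exact Real.rpow_le_rpow_of_nonpos (ell_pos t) (ell_mono (by linarith) (by linarith)) (by linarith)
      gcongr
  · rw [h0] at hb
    rcases hA with h | h | ⟨-, h1, h2, h3⟩ | ⟨-, h1, h2⟩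
    · simp at h
    · simp at h
    · have hr : 0 < q.toReal := ENNReal.toReal_pos (by intro h; simp [h] at h1) h2.ne
      have hAr : A.2 * q.toReal = -1 := by
        have : A.2 = - q.toReal⁻¹ := by linarith
        rw [this]; field_simp
      refine ⟨0, fun a => ENNReal.ofReal ((Real.log (ell a)) ^ (-q.toReal⁻¹)), hb, ?_, ?_⟩
      · have := ENNReal.tendsto_ofReal ((tendsto_rpow_neg_atTop (inv_pos.2 hr)).comp
          (Real.tendsto_log_atTop.comp tendsto_ell))
        simpa using this
      · filter_upwards [eventually_ge_atTop (Real.exp 1)] with a ha f hf t ht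
        have ha1 : 1 < a := lt_of_lt_of_le (by simp) ha
        have hell : ellA (0, -0) t = 1 := by unfold ellA; simp
        rw [hell, ENNReal.ofReal_one, mul_one]
        refine (rearr_anti f (show a ≤ t + a by linarith)).trans ?_
        have hb := fin_bound q A h1 h2 f hf 1 a le_rfl
        have hla : 1 < ell a := by
          rw [ell_eq ha1.le]; linarith [Real.log_pos ha1]
        rw [hAr] at hb
        refine pow_mul_le hr (Real.log_pos hla) (le_trans (le_of_eq ?_) hb)
        congr 1
        have hcg : ∫⁻ u in Set.Ioc 1 a, ENNReal.ofReal (u⁻¹ * ell u ^ (-1:ℝ)) =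
            ∫⁻ u in Set.Ioc 1 a, ENNReal.ofReal (u⁻¹ / (1 + Real.log u)) := by
          apply setLIntegral_congr_fun measurableSet_Ioc
          intro u hu
          simp only
          rw [ell_eq hu.1.le, Real.rpow_neg_one, div_eq_mul_inv]
        have hci : ContinuousOn (fun u : ℝ => u⁻¹ / (1 + Real.log u)) (Set.uIcc 1 a) := by
          rw [Set.uIcc_of_le ha1.le]
          have n1 : ∀ u ∈ Set.Icc 1 a, u ≠ 0 := fun u hu => by linarith [hu.1]
          apply ContinuousOn.div
          · exact continuousOn_id.inv₀ n1
          · exact continuousOn_const.add (continuousOn_id.log n1)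
          · intro u hu
            linarith [Real.log_nonneg hu.1]
        have hii := hci.intervalIntegrable (μ := volume)
        rw [hcg, ← ofReal_integral_eq_lintegral_ofReal
          ((intervalIntegrable_iff_integrableOn_Ioc_of_le ha1.le).1 hii)]
        · rw [← intervalIntegral.integral_of_le ha1.le,
            intervalIntegral.integral_eq_sub_of_hasDerivAt (f := fun u => Real.log (1 + Real.log u)) _ hii]
          · rw [ell_eq ha1.le]; simp
          · intro u hu
            rw [Set.uIcc_of_le ha1.le] at hu
            have n1 : u ≠ 0 := by linarith [hu.1]
            have n2 : 1 + Real.log u ≠ 0 := by linarith [Real.log_nonneg hu.1]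
            exact ((Real.hasDerivAt_log n1).const_add 1).log n2
        · filter_upwards [ae_restrict_mem measurableSet_Ioc] with u hu
          have l1 := Real.log_nonneg hu.1.le
          have : 0 < u := by linarith [hu.1]
          simp only [Pi.zero_apply]
          positivity
    · exact absurd h1 hq.ne

/-- for `p = r = ∞`, under either `α_∞ + 1/q > 0` and
`α_∞ + 1/q > β_∞ + 1/s`, or `q < ∞` and `0 = α_∞ + 1/q > β_∞ + 1/s`, the tails are
uniformly small. -/
theorem lz_tail_vanishes_p_infty (q s : ℝ≥0∞) (A B : ℝ × ℝ)
    (hA : LZAdmissible ∞ q A) (hB : LZAdmissible ∞ s B)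
    (hcond : (0 < A.2 + q.toReal⁻¹ ∧ B.2 + s.toReal⁻¹ < A.2 + q.toReal⁻¹) ∨
      (q < ∞ ∧ A.2 + q.toReal⁻¹ = 0 ∧ B.2 + s.toReal⁻¹ < A.2 + q.toReal⁻¹)) :
    Tendsto (fun a : ℝ =>
        ⨆ (f : ℝ → ℝ≥0∞) (_ : Measurable f) (_ : lzNorm ∞ q A f ≤ 1),
          lzNorm ∞ s B ((Set.Ioi a).indicator fun t => rearr μI f t))
      atTop (nhds 0) := by
  obtain ⟨γ, η, hγ, hη, hev⟩ := decay q A (B.2 + s.toReal⁻¹) hA hcond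
  obtain ⟨K, hK, hKf⟩ := norm_bound s B γ hB hγ
  have hlim : Tendsto (fun a => η a * K) atTop (𝓝 0) := by
    have := ENNReal.Tendsto.mul_const (b := K) hη (Or.inr hK)
    rwa [zero_mul] at this
  refine tendsto_of_tendsto_of_tendsto_of_le_of_le' tendsto_const_nhds hlim
    (Eventually.of_forall fun _ => zero_le) ?_
  filter_upwards [hev] with a ha
  refine iSup_le fun f => iSup_le fun _ => iSup_le fun hf => ?_
  unfold lzNorm
  apply hKf
  intro t ht
  exact (rearr_tail _ (rearr_anti f) a t).trans (ha f hf t ht)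


end
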